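/- Let H : ℝ^m → ℝ be of class C¹ and, for x ≠ x', define the midpoint discrete gradient ∇̄H(x, x') = ∇H(m) + ((H(x') − H(x) − ∇H(m)·(x' − x))/‖x' − x‖²)(x' − x), where m = (x + x')/2. Then (i) for all x ≠ x', ∇̄H(x, x')·(x' − x) = H(x') − H(x); and (ii) for every x₀ ∈ ℝ^m, ∇̄H(x, x') converges to ∇H(x₀) as (x, x') → (x₀, x₀) with x ≠ x'. Hence the formula extends continuously to the diagonal by ∇̄H(x, x) = ∇H(x), making it a discrete gradient of H. -/

import Mathlib

open scoped Gradient RealInnerProductSpace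

/-- The midpoint discrete gradient of `H : ℝ^m → ℝ` (for `x ≠ x'`):
`∇̄H(x, x') = ∇H(m) + ((H(x') − H(x) − ∇H(m)·(x'−x))/‖x'−x‖²)(x'−x)`, `m = (x+x')/2`,
where `∇` is the gradient and `‖·‖` the Euclidean norm. -/
noncomputable def midpointDiscreteGradient {m : ℕ} (H : EuclideanSpace ℝ (Fin m) → ℝ)
    (x x' : EuclideanSpace ℝ (Fin m)) : EuclideanSpace ℝ (Fin m) :=
  ∇ H ((1 / 2 : ℝ) • (x + x')) +
    ((H x' - H x - ⟪∇ H ((1 / 2 : ℝ) • (x + x')), x' - x⟫) / ‖x' - x‖ ^ 2) • (x' - x)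

open Filter Asymptotics Topology in
theorem Asymptotics.IsLittleO.tendsto_div_norm_sq_smul {α E : Type*} [NormedAddCommGroup E]
    [NormedSpace ℝ E] {l : Filter α} {r : α → ℝ} {v : α → E} (h : r =o[l] v) :
    Tendsto (fun a => (r a / ‖v a‖ ^ 2) • v a) l (𝓝 0) := by
  rw [tendsto_zero_iff_norm_tendsto_zero]
  refine h.norm_norm.tendsto_div_nhds_zero.congr fun a => ?_
  rcases eq_or_ne ‖v a‖ 0 with hv | hv
  · simp [hv]
  · rw [norm_smul, norm_div, norm_pow, _root_.norm_norm]
    field_simp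

theorem inner_add_div_norm_sq_smul_right {E : Type*} [NormedAddCommGroup E]
    [InnerProductSpace ℝ E] (g : E) {v : E} (hv : v ≠ 0) (c : ℝ) :
    ⟪g + ((c - ⟪g, v⟫) / ‖v‖ ^ 2) • v, v⟫ = c := by
  have : ‖v‖ ≠ 0 := norm_ne_zero_iff.mpr hv
  rw [inner_add_left, real_inner_smul_left, real_inner_self_eq_norm_sq]
  field_simp
  ring

theorem ContDiff.continuous_gradient {E : Type*} [NormedAddCommGroup E]
    [InnerProductSpace ℝ E] [CompleteSpace E] {f : E → ℝ} (hf : ContDiff ℝ 1 f) :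
    Continuous (∇ f) :=
  (InnerProductSpace.toDual ℝ E).symm.continuous.comp (hf.continuous_fderiv one_ne_zero)

open Filter Asymptotics Topology in
/-- If `g` tends to the gradient of a `C¹` function at `x₀` as `(x, x') → (x₀, x₀)`, then
`g (x, x')` gives the increment `f x' - f x` up to a remainder `o(x' - x)`. -/
theorem ContDiff.isLittleO_sub_sub_inner {E : Type*} [NormedAddCommGroup E]
    [InnerProductSpace ℝ E] [CompleteSpace E] {f : E → ℝ} (hf : ContDiff ℝ 1 f) {x₀ : E}
    {g : E × E → E} (hg : Tendsto g (𝓝 (x₀, x₀)) (𝓝 (∇ f x₀))) :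
    (fun p : E × E => f p.2 - f p.1 - ⟪g p, p.2 - p.1⟫) =o[𝓝 (x₀, x₀)]
      fun p => p.2 - p.1 := by
  have hstrict := ((hf.contDiffAt (x := x₀)).hasStrictFDerivAt one_ne_zero).isLittleO
  have hswap := hstrict.comp_tendsto (continuous_swap.tendsto (x₀, x₀))
  have hinner : (fun p : E × E => ⟪g p - ∇ f x₀, p.2 - p.1⟫) =o[𝓝 (x₀, x₀)]
      fun p => p.2 - p.1 := by
    have hzero : (fun p => g p - ∇ f x₀) =o[𝓝 (x₀, x₀)] fun _ => (1 : ℝ) :=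
      (isLittleO_one_iff ℝ).mpr (tendsto_sub_nhds_zero_iff.mpr hg)
    have hmul := hzero.norm_left.mul_isBigO
      (isBigO_refl (fun p : E × E => ‖p.2 - p.1‖) (𝓝 (x₀, x₀)))
    simp only [one_mul] at hmul
    exact (IsBigO.of_norm_le fun p => norm_inner_le_norm _ _).trans_isLittleO hmul.of_norm_right
  refine (hswap.sub hinner).congr_left fun p => ?_
  have hgrad : fderiv ℝ f x₀ (p.2 - p.1) = ⟪∇ f x₀, p.2 - p.1⟫ := by
    simp [gradient]
  simp only [Function.comp_apply, Prod.fst_swap, Prod.snd_swap, hgrad, inner_sub_left]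
  ring


/-- For `H` of class `C¹`: (i) the midpoint discrete gradient satisfies the discrete
gradient identity `∇̄H(x, x')·(x'−x) = H(x') − H(x)` off the diagonal, and (ii) it
converges to `∇H(x₀)` as `(x, x') → (x₀, x₀)` with `x ≠ x'`, hence extends continuously
to the diagonal by `∇̄H(x, x) = ∇H(x)`, making it a discrete gradient of `H`. -/
theorem midpointDiscreteGradient_is_discrete_gradient {m : ℕ}
    (H : EuclideanSpace ℝ (Fin m) → ℝ) (hH : ContDiff ℝ 1 H) :
    (∀ x x' : EuclideanSpace ℝ (Fin m), x ≠ x' →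
      ⟪midpointDiscreteGradient H x x', x' - x⟫ = H x' - H x) ∧
    (∀ x₀ : EuclideanSpace ℝ (Fin m),
      Filter.Tendsto
        (fun p : EuclideanSpace ℝ (Fin m) × EuclideanSpace ℝ (Fin m) =>
          midpointDiscreteGradient H p.1 p.2)
        (nhdsWithin (x₀, x₀) {p | p.1 ≠ p.2})
        (nhds (∇ H x₀))) := by
  refine ⟨fun x x' hne => inner_add_div_norm_sq_smul_right _ (sub_ne_zero.mpr hne.symm) _,
    fun x₀ => Filter.Tendsto.mono_left ?_ nhdsWithin_le_nhds⟩
  have hcont : Continuous fun p : EuclideanSpace ℝ (Fin m) × EuclideanSpace ℝ (Fin m) =>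
      ∇ H ((1 / 2 : ℝ) • (p.1 + p.2)) :=
    hH.continuous_gradient.comp (by fun_prop)
  have hmid : (1 / 2 : ℝ) • (x₀ + x₀) = x₀ := by
    rw [← two_smul ℝ x₀, smul_smul]
    norm_num
  have hg := hcont.tendsto (x₀, x₀)
  simp only [hmid] at hg
  simpa only [midpointDiscreteGradient, add_zero] using
    hg.add (hH.isLittleO_sub_sub_inner hg).tendsto_div_norm_sq_smul
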